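/- Let F : ℝ → ℝ be locally Lipschitz with F(0) = 0, satisfying hypothesis (H)_1 and hypothesis (H)_5 with exponent q > 2, i.e., there exist K > 0 and T > 0 such that |ξ| ≤ K|t|^{q−1} for all |t| ≥ T and all ξ ∈ ∂F(t). Then for every ε > 0 there exists C_ε > 0 such that |F(t)| ≤ ε t² + C_ε |t|^q for every t ∈ ℝ. -/

import Mathlib

open Filter Real

/-- The Clarke generalized directional derivative of `F : ℝ → ℝ` at `t` in direction `s`:
`F⁰(t;s) = limsup_{w → t, τ → 0⁺} (F(w + τs) − F(w))/τ`. -/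
noncomputable def clarkeDeriv (F : ℝ → ℝ) (t s : ℝ) : ℝ :=
  Filter.limsup (fun p : ℝ × ℝ => (F (p.1 + p.2 * s) - F p.1) / p.2)
    ((nhds t) ×ˢ (nhdsWithin 0 (Set.Ioi 0)))

/-- The Clarke subdifferential `∂F(t) = {ξ : ξ·s ≤ F⁰(t;s) for all s}`. -/
def clarkeSubdiff (F : ℝ → ℝ) (t : ℝ) : Set ℝ :=
  {ξ : ℝ | ∀ s : ℝ, ξ * s ≤ clarkeDeriv F t s}

open Topology

/-- The difference quotients in the definition of `clarkeDeriv` are bounded above near `t`. -/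
lemma LocallyLipschitz.isBoundedUnder_clarke_quotient {F : ℝ → ℝ} (hF : LocallyLipschitz F)
    (t s : ℝ) :
    IsBoundedUnder (· ≤ ·) (𝓝 t ×ˢ 𝓝[>] (0 : ℝ))
      (fun p : ℝ × ℝ => (F (p.1 + p.2 * s) - F p.1) / p.2) := by
  obtain ⟨K, U, hU, hK⟩ := hF t
  refine isBoundedUnder_of_eventually_le (a := K * |s|) ?_
  have hfst : Tendsto (fun p : ℝ × ℝ => p.1) (𝓝 t ×ˢ 𝓝[>] (0 : ℝ)) (𝓝 t) := tendsto_fst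
  have hsnd : Tendsto (fun p : ℝ × ℝ => p.2) (𝓝 t ×ˢ 𝓝[>] (0 : ℝ)) (𝓝[>] 0) := tendsto_snd
  have hadd : Tendsto (fun p : ℝ × ℝ => p.1 + p.2 * s) (𝓝 t ×ˢ 𝓝[>] (0 : ℝ)) (𝓝 t) := by
    simpa using hfst.add ((hsnd.mono_right nhdsWithin_le_nhds).mul_const s)
  filter_upwards [hfst hU, hadd hU, hsnd self_mem_nhdsWithin] with p h₁ h₂ h₃
  have hpos : 0 < p.2 := h₃
  rw [div_le_iff₀ hpos]
  have h := hK.dist_le_mul _ h₂ _ h₁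
  rw [Real.dist_eq, Real.dist_eq, add_sub_cancel_left, abs_mul, abs_of_pos hpos] at h
  linarith [le_abs_self (F (p.1 + p.2 * s) - F p.1)]

/-- A lower bound for the difference quotients along one path of base points bounds the Clarke
derivative from below. -/
lemma LocallyLipschitz.le_clarkeDeriv {F : ℝ → ℝ} (hF : LocallyLipschitz F) {t s a : ℝ}
    {w : ℝ → ℝ} (hw : Tendsto w (𝓝[>] 0) (𝓝 t))
    (h : ∀ᶠ τ in 𝓝[>] (0 : ℝ), a * τ ≤ F (w τ + τ * s) - F (w τ)) :
    a ≤ clarkeDeriv F t s := by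
  refine le_limsup_of_frequently_le ?_ (hF.isBoundedUnder_clarke_quotient t s)
  refine (hw.prodMk tendsto_id).frequently (Eventually.frequently ?_)
  filter_upwards [h, self_mem_nhdsWithin] with τ hτ hpos
  exact (le_div_iff₀ (show (0 : ℝ) < τ from hpos)).2 hτ

lemma LocallyLipschitz.mem_clarkeSubdiff_of_isLocalExtr {F : ℝ → ℝ} (hF : LocallyLipschitz F)
    {m c : ℝ} (hc : IsLocalExtr (fun x => F x - m * x) c) : m ∈ clarkeSubdiff F c := by
  intro s
  have hτ : Tendsto (fun τ : ℝ => τ * s) (𝓝[>] 0) (𝓝 0) := by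
    simpa using ((tendsto_id (x := 𝓝 (0 : ℝ))).mono_left nhdsWithin_le_nhds).mul_const s
  rcases hc with hc | hc
  · refine hF.le_clarkeDeriv (w := fun _ => c) tendsto_const_nhds ?_
    have h : Tendsto (fun τ : ℝ => c + τ * s) (𝓝[>] 0) (𝓝 c) := by simpa using hτ.const_add c
    filter_upwards [h.eventually hc] with τ h
    linarith
  · have h : Tendsto (fun τ : ℝ => c - τ * s) (𝓝[>] 0) (𝓝 c) := by simpa using hτ.const_sub c
    refine hF.le_clarkeDeriv h ?_
    filter_upwards [h.eventually hc] with τ h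
    rw [sub_add_cancel]
    linarith

/-- Lebourg's mean value theorem on the real line. -/
lemma LocallyLipschitz.exists_mem_clarkeSubdiff {F : ℝ → ℝ} (hF : LocallyLipschitz F) {a b : ℝ}
    (hab : a < b) : ∃ c ∈ Set.Ioo a b, ∃ ξ ∈ clarkeSubdiff F c, F b - F a = ξ * (b - a) := by
  have hm : (F b - F a) / (b - a) * (b - a) = F b - F a :=
    div_mul_cancel₀ _ (sub_pos.2 hab).ne'
  obtain ⟨c, hc, hext⟩ := exists_isLocalExtr_Ioo
    (f := fun x => F x - (F b - F a) / (b - a) * x) hab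
    (hF.continuous.sub (continuous_const.mul continuous_id)).continuousOn (by linarith)
  exact ⟨c, hc, _, hF.mem_clarkeSubdiff_of_isLocalExtr hext, hm.symm⟩

/-- Bounds on the Clarke subdifferential on an open interval bound the increment of `F`. -/
lemma LocallyLipschitz.abs_sub_le_of_clarkeSubdiff {F : ℝ → ℝ} (hF : LocallyLipschitz F)
    {a b B : ℝ} (hab : a < b) (hB : ∀ c ∈ Set.Ioo a b, ∀ ξ ∈ clarkeSubdiff F c, |ξ| ≤ B) :
    |F b - F a| ≤ B * (b - a) := by
  obtain ⟨c, hc, ξ, hξ, h⟩ := hF.exists_mem_clarkeSubdiff hab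
  rw [h, abs_mul, abs_of_pos (sub_pos.2 hab)]
  exact mul_le_mul_of_nonneg_right (hB c hc ξ hξ) (sub_pos.2 hab).le

lemma LocallyLipschitz.abs_le_mul_sq {F : ℝ → ℝ} (hF : LocallyLipschitz F) (hF0 : F 0 = 0)
    {ε δ : ℝ} (hε : 0 < ε)
    (H : ∀ t : ℝ, 0 < |t| → |t| < δ → ∀ ξ ∈ clarkeSubdiff F t, |ξ| ≤ ε * |t|)
    {t : ℝ} (ht : |t| < δ) : |F t| ≤ ε * t ^ 2 := by
  have hB : ∀ c, 0 < |c| → |c| < |t| → ∀ ξ ∈ clarkeSubdiff F c, |ξ| ≤ ε * |t| :=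
    fun c h₀ h₁ ξ hξ => (H c h₀ (h₁.trans ht) ξ hξ).trans (by gcongr)
  rcases lt_trichotomy t 0 with h | rfl | h
  · have := hF.abs_sub_le_of_clarkeSubdiff h (B := ε * |t|) fun c hc =>
      hB c (abs_pos.2 hc.2.ne) (by rw [abs_of_neg hc.2, abs_of_neg h]; linarith [hc.1])
    rw [hF0, zero_sub, abs_neg, abs_of_neg h] at this
    linarith
  · simp [hF0]
  · have := hF.abs_sub_le_of_clarkeSubdiff h (B := ε * |t|) fun c hc =>
      hB c (abs_pos.2 hc.1.ne') (by rw [abs_of_pos hc.1, abs_of_pos h]; exact hc.2)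
    rw [hF0, sub_zero, abs_of_pos h] at this
    linarith

lemma LocallyLipschitz.exists_abs_le_add_rpow {F : ℝ → ℝ} (hF : LocallyLipschitz F)
    {q K T : ℝ} (hq : 1 ≤ q) (hK : 0 < K) (hT : 0 < T)
    (H : ∀ t : ℝ, T ≤ |t| → ∀ ξ ∈ clarkeSubdiff F t, |ξ| ≤ K * |t| ^ (q - 1)) :
    ∃ M, ∀ t, |F t| ≤ M + K * |t| ^ q := by
  obtain ⟨M, hM⟩ := (isCompact_Icc (a := -T) (b := T)).exists_bound_of_continuousOn
    hF.continuous.continuousOn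
  simp only [Real.norm_eq_abs] at hM
  refine ⟨M, fun t => ?_⟩
  have hnn : 0 ≤ K * |t| ^ (q - 1) := by positivity
  have hB : ∀ c, T ≤ |c| → |c| ≤ |t| → ∀ ξ ∈ clarkeSubdiff F c, |ξ| ≤ K * |t| ^ (q - 1) :=
    fun c h₀ h₁ ξ hξ => (H c h₀ ξ hξ).trans <| mul_le_mul_of_nonneg_left
      (Real.rpow_le_rpow (abs_nonneg c) h₁ (by linarith)) hK.le
  have hpow : t ≠ 0 → K * |t| ^ (q - 1) * |t| = K * |t| ^ q := fun h => by
    rw [mul_assoc, Real.rpow_sub_one (abs_pos.2 h).ne', div_mul_cancel₀ _ (abs_pos.2 h).ne']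
  rcases lt_or_ge t (-T) with h | h
  · have ht : t < 0 := by linarith
    have h₁ := hF.abs_sub_le_of_clarkeSubdiff h fun c hc =>
      have hc0 : c < 0 := by linarith [hc.2]
      hB c (by rw [abs_of_neg hc0]; linarith [hc.2])
        (by rw [abs_of_neg hc0, abs_of_neg ht]; linarith [hc.1])
    have h₂ := mul_le_mul_of_nonneg_left
      (show -T - t ≤ |t| by rw [abs_of_neg ht]; linarith) hnn
    have h₃ := hM (-T) ⟨le_rfl, by linarith⟩
    have h₄ := abs_sub_abs_le_abs_sub (F t) (F (-T))
    rw [abs_sub_comm] at h₄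
    linarith [hpow ht.ne]
  rcases le_or_gt t T with h' | h'
  · have : 0 ≤ K * |t| ^ q := by positivity
    linarith [hM t ⟨h, h'⟩]
  · have ht : 0 < t := by linarith
    have h₁ := hF.abs_sub_le_of_clarkeSubdiff h' fun c hc =>
      have hc0 : 0 < c := by linarith [hc.1]
      hB c (by rw [abs_of_pos hc0]; exact hc.1.le)
        (by rw [abs_of_pos hc0, abs_of_pos ht]; exact hc.2.le)
    have h₂ := mul_le_mul_of_nonneg_left
      (show t - T ≤ |t| by rw [abs_of_pos ht]; linarith) hnn
    have h₃ := hM T ⟨by linarith, le_rfl⟩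
    have h₄ := abs_sub_abs_le_abs_sub (F t) (F T)
    linarith [hpow ht.ne']

theorem stmt_6 (F : ℝ → ℝ) (hF : LocallyLipschitz F) (hF0 : F 0 = 0)
    (H1 : ∀ ε > (0 : ℝ), ∃ δ > (0 : ℝ), ∀ t : ℝ, 0 < |t| → |t| < δ →
      ∀ ξ ∈ clarkeSubdiff F t, |ξ| ≤ ε * |t|)
    (q : ℝ) (hq : 2 < q)
    (H5 : ∃ K > (0 : ℝ), ∃ T > (0 : ℝ), ∀ t : ℝ, T ≤ |t| →
      ∀ ξ ∈ clarkeSubdiff F t, |ξ| ≤ K * |t| ^ (q - 1)) :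
    ∀ ε > (0 : ℝ), ∃ C > (0 : ℝ), ∀ t : ℝ,
      |F t| ≤ ε * t ^ 2 + C * |t| ^ q := by
  intro ε hε
  obtain ⟨δ, hδ, hnear⟩ := H1 ε hε
  obtain ⟨K, hK, T, hT, hfar⟩ := H5
  obtain ⟨M, hM⟩ := hF.exists_abs_le_add_rpow (by linarith) hK hT hfar
  have hδq : 0 < δ ^ q := Real.rpow_pos_of_pos hδ q
  refine ⟨|M| / δ ^ q + K, by positivity, fun t => ?_⟩
  rcases lt_or_ge |t| δ with ht | ht
  · have h₁ := hF.abs_le_mul_sq hF0 hε hnear ht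
    have h₂ : 0 ≤ (|M| / δ ^ q + K) * |t| ^ q := by positivity
    linarith
  · have h₁ : |M| ≤ |M| / δ ^ q * |t| ^ q := by
      rw [div_mul_eq_mul_div, le_div_iff₀ hδq]
      exact mul_le_mul_of_nonneg_left (Real.rpow_le_rpow hδ.le ht (by linarith)) (abs_nonneg M)
    have h₂ : 0 ≤ ε * t ^ 2 := by positivity
    linarith [hM t, le_abs_self M]
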